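/- arXiv:1609.07860 — 4 statements merged into one kernel-verified Lean document; each statement's English description precedes it below -/
import Mathlib

section
/- Let n ≥ 1, let p_i ∈ (0,1) for i = 1,…,n, let r_i ≥ 0, θ_i ≥ 0, and let η ≥ 0. If a permutation σ* of {1,…,n} maximizes J(σ) = R̄(σ) − η T̄(σ) over all permutations σ of {1,…,n}, then the sequence of numbers r_{σ*(i)} − η θ_{σ*(i)}/p_{σ*(i)}, i = 1,…,n, is ordered non-increasingly; that is, for all 1 ≤ k ≤ n−1, r_{σ*(k)} − η θ_{σ*(k)}/p_{σ*(k)} ≥ r_{σ*(k+1)} − η θ_{σ*(k+1)}/p_{σ*(k+1)}. -/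
open Finset

/-- `cSched p σ i` is the probability `c_{i}` that the first success occurs exactly at the
(0-based) position `i` of the scheduling sequence `σ`:
`c_i(σ) = p_{σ(i)} ∏_{j<i} (1 - p_{σ(j)})`. -/
noncomputable def cSched {n : ℕ} (p : Fin n → ℝ) (σ : Equiv.Perm (Fin n)) (i : Fin n) : ℝ :=
  p (σ i) * ∏ j ∈ Finset.Iio i, (1 - p (σ j))

/-- `cLastSched p σ = c_{n+1}(σ) = ∏_{j=1}^n (1 - p_{σ(j)})`, the probability of no success. -/
noncomputable def cLastSched {n : ℕ} (p : Fin n → ℝ) (σ : Equiv.Perm (Fin n)) : ℝ :=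
  ∏ j, (1 - p (σ j))

/-- Eventual expected reward `R̄(σ) = ∑_i r_{σ(i)} c_i(σ)`. -/
noncomputable def Rbar {n : ℕ} (r p : Fin n → ℝ) (σ : Equiv.Perm (Fin n)) : ℝ :=
  ∑ i, r (σ i) * cSched p σ i

/-- Expected end time
`T̄(σ) = c_{n+1}(σ) ∑_k θ_{σ(k)} + ∑_i c_i(σ) ∑_{k ≤ i} θ_{σ(k)}`. -/
noncomputable def Tbar {n : ℕ} (p θ : Fin n → ℝ) (σ : Equiv.Perm (Fin n)) : ℝ :=
  cLastSched p σ * (∑ k, θ (σ k)) + ∑ i, cSched p σ i * ∑ k ∈ Finset.Iic i, θ (σ k)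

/-- Tradeoff objective `J(σ) = R̄(σ) - η T̄(σ)`. -/
noncomputable def Jobj {n : ℕ} (r p θ : Fin n → ℝ) (η : ℝ) (σ : Equiv.Perm (Fin n)) : ℝ :=
  Rbar r p σ - η * Tbar p θ σ

/-- `z_i(σ) = r_{σ(i)} - η ∑_{k ≤ i} θ_{σ(k)}` (0-based position `i`). -/
noncomputable def zSeq {n : ℕ} (r θ : Fin n → ℝ) (η : ℝ) (σ : Equiv.Perm (Fin n))
    (i : Fin n) : ℝ :=
  r (σ i) - η * ∑ k ∈ Finset.Iic i, θ (σ k)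

/-- Residual value: `Vres … σ k` is the paper's
`V_k(σ) = ∑_{i=k+1}^n z_i(σ) p_{σ(i)} ∏_{j=k+1}^{i-1} (1 - p_{σ(j)})`,
where the paper's 1-based position `k+1` corresponds to the 0-based index `k : Fin n`. -/
noncomputable def Vres {n : ℕ} (r p θ : Fin n → ℝ) (η : ℝ) (σ : Equiv.Perm (Fin n))
    (k : Fin n) : ℝ :=
  ∑ i ∈ Finset.Ici k, zSeq r θ η σ i * p (σ i) * ∏ j ∈ Finset.Ico k i, (1 - p (σ j))

lemma cLastSched_add_sum_Ici_cSched {n : ℕ} (p : Fin n → ℝ) (σ : Equiv.Perm (Fin n))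
    (k : Fin n) :
    cLastSched p σ + ∑ i ∈ Finset.Ici k, cSched p σ i = ∏ j ∈ Finset.Iio k, (1 - p (σ j)) := by
  have hlt : ∀ i : Fin n, univ.filter (· < i) = Finset.Iio i := fun i => by ext; simp
  have hall := Finset.prod_one_sub_ordered (univ : Finset (Fin n)) fun i => p (σ i)
  have hIio := Finset.prod_one_sub_ordered (Finset.Iio k) fun i => p (σ i)
  have hfilter : ∀ i ∈ Finset.Iio k, (Finset.Iio k).filter (· < i) = Finset.Iio i := by
    intro i hi
    ext j
    simp only [Finset.mem_filter, Finset.mem_Iio] at hi ⊢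
    exact ⟨fun h => h.2, fun h => ⟨h.trans hi, h⟩⟩
  rw [Finset.sum_congr rfl fun i hi => by rw [hfilter i hi]] at hIio
  simp only [hlt] at hall
  have hcompl : (Finset.Iio k)ᶜ = Finset.Ici k := by ext; simp
  have hsplit := Finset.sum_add_sum_compl (Finset.Iio k) (cSched p σ)
  rw [hcompl] at hsplit
  simp only [cLastSched, cSched] at hsplit ⊢
  linarith

lemma Tbar_eq_sum {n : ℕ} (p θ : Fin n → ℝ) (σ : Equiv.Perm (Fin n)) :
    Tbar p θ σ = ∑ k, θ (σ k) * ∏ j ∈ Finset.Iio k, (1 - p (σ j)) := by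
  have hswap : ∑ i, cSched p σ i * ∑ k ∈ Finset.Iic i, θ (σ k) =
      ∑ k, ∑ i ∈ Finset.Ici k, cSched p σ i * θ (σ k) := by
    simp only [Finset.mul_sum]
    exact Finset.sum_comm' (by simp)
  rw [Tbar, hswap, Finset.mul_sum, ← Finset.sum_add_distrib]
  refine Finset.sum_congr rfl fun k _ => ?_
  rw [← cLastSched_add_sum_Ici_cSched, ← Finset.sum_mul]
  ring

lemma Jobj_eq_sum {n : ℕ} (r p θ : Fin n → ℝ) (η : ℝ) (σ : Equiv.Perm (Fin n)) :
    Jobj r p θ η σ =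
      ∑ k, (r (σ k) * p (σ k) - η * θ (σ k)) * ∏ j ∈ Finset.Iio k, (1 - p (σ j)) := by
  rw [Jobj, Rbar, Tbar_eq_sum, Finset.mul_sum, ← Finset.sum_sub_distrib]
  refine Finset.sum_congr rfl fun k _ => ?_
  rw [cSched]
  ring

/-- Exchanging the opportunities at two consecutive positions. -/
lemma Jobj_sub_Jobj_mul_swap {n : ℕ} (r p θ : Fin n → ℝ) (η : ℝ) (σ : Equiv.Perm (Fin n))
    {k l : Fin n} (hkl : (k : ℕ) + 1 = l) :
    Jobj r p θ η σ - Jobj r p θ η (σ * Equiv.swap k l) =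
      ((r (σ k) * p (σ k) - η * θ (σ k)) * p (σ l) -
        (r (σ l) * p (σ l) - η * θ (σ l)) * p (σ k)) *
        ∏ j ∈ Finset.Iio k, (1 - p (σ j)) := by
  have hne : k ≠ l := by rintro rfl; omega
  have hIio : Finset.Iio l = insert k (Finset.Iio k) := by
    ext j
    simp only [Finset.mem_Iio, Finset.mem_insert, Fin.lt_def, Fin.ext_iff]
    omega
  have hbefore : ∏ j ∈ Finset.Iio k, (1 - p (σ (Equiv.swap k l j))) =
      ∏ j ∈ Finset.Iio k, (1 - p (σ j)) := by
    refine Finset.prod_congr rfl fun j hj => ?_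
    have hj : j < k := by simpa using hj
    rw [Equiv.swap_apply_of_ne_of_ne hj.ne (by rintro rfl; rw [Fin.lt_def] at hj; omega)]
  rw [Jobj_eq_sum, Jobj_eq_sum, ← Finset.sum_sub_distrib, Fintype.sum_eq_add k l hne]
  · simp only [Equiv.Perm.mul_apply, Equiv.swap_apply_left, Equiv.swap_apply_right, hIio]
    rw [Finset.prod_insert (by simp), Finset.prod_insert (by simp), hbefore,
      Equiv.swap_apply_left]
    ring
  · rintro i ⟨hik, hil⟩
    have hprod : ∏ j ∈ Finset.Iio i, (1 - p (σ (Equiv.swap k l j))) =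
        ∏ j ∈ Finset.Iio i, (1 - p (σ j)) := by
      refine Finset.prod_equiv (Equiv.swap k l) (fun j => ?_) fun _ _ => rfl
      rw [Finset.mem_Iio, Finset.mem_Iio, Equiv.swap_apply_def]
      simp only [ne_eq, Fin.ext_iff] at hik hil
      split_ifs with hjk hjl
      · subst hjk; simp only [Fin.lt_def]; omega
      · subst hjl; simp only [Fin.lt_def]; omega
      · rfl
    simp only [Equiv.Perm.mul_apply, Equiv.swap_apply_of_ne_of_ne hik hil, hprod, sub_self]

/-- If a permutation `σ` maximizes `J(σ) = R̄(σ) - η T̄(σ)` over all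
permutations, then the sequence `r_{σ(i)} - η θ_{σ(i)} / p_{σ(i)}` is ordered non-increasingly. -/
theorem optimal_implies_sorted {n : ℕ} (hn : 1 ≤ n) (r p θ : Fin n → ℝ)
    (hp : ∀ i, p i ∈ Set.Ioo (0 : ℝ) 1) (hr : ∀ i, 0 ≤ r i) (hθ : ∀ i, 0 ≤ θ i)
    (η : ℝ) (hη : 0 ≤ η) (σ : Equiv.Perm (Fin n))
    (hopt : ∀ τ : Equiv.Perm (Fin n), Jobj r p θ η τ ≤ Jobj r p θ η σ) :
    ∀ (k : Fin n) (hk : (k : ℕ) + 1 < n),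
      r (σ ⟨(k : ℕ) + 1, hk⟩) - η * θ (σ ⟨(k : ℕ) + 1, hk⟩) / p (σ ⟨(k : ℕ) + 1, hk⟩) ≤
        r (σ k) - η * θ (σ k) / p (σ k) := by
  intro k hk
  set l : Fin n := ⟨(k : ℕ) + 1, hk⟩
  have hdiff := Jobj_sub_Jobj_mul_swap r p θ η σ (k := k) (l := l) rfl
  have hpos : 0 < ∏ j ∈ Finset.Iio k, (1 - p (σ j)) :=
    Finset.prod_pos fun j _ => sub_pos.2 (hp (σ j)).2
  have hle := nonneg_of_mul_nonneg_left (hdiff ▸ sub_nonneg.2 (hopt _)) hpos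
  have hk0 := (hp (σ k)).1
  have hl0 := (hp (σ l)).1
  have hratio : ∀ i, 0 < p i → r i - η * θ i / p i = (r i * p i - η * θ i) / p i :=
    fun i hi => by field_simp
  rw [hratio _ hk0, hratio _ hl0, div_le_div_iff₀ hl0 hk0]
  linarith
end

section
/- Let n ≥ 1, let p_i ∈ (0,1] for i = 1,…,n, let r_i ≥ 0, θ_i ≥ 0, and let η ≥ 0. If a permutation σ of {1,…,n} is such that the sequence r_{σ(i)} − η θ_{σ(i)}/p_{σ(i)}, i = 1,…,n, is ordered non-increasingly, then σ maximizes J over all permutations of {1,…,n}: for every permutation τ of {1,…,n}, J(σ) ≥ J(τ). In particular, a tradeoff-optimal scheduling sequence can be obtained by sorting the n numbers r_i − η θ_i/p_i non-increasingly. -/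
open Finset

/-- The product over the positions before `i.succ` splits off the factor at position `0`. -/
theorem prod_Iio_fin_succ {n : ℕ} (f : Fin (n + 1) → ℝ) (i : Fin n) :
    ∏ j ∈ Finset.Iio i.succ, f j = f 0 * ∏ j ∈ Finset.Iio i, f j.succ := by
  have h : Finset.Iio i.succ = insert 0 ((Finset.Iio i).map (Fin.succEmb n)) := by
    ext j
    cases j using Fin.cases <;> simp
  rw [h, Finset.prod_insert (by simp), Finset.prod_map]
  rfl

/-- The sum over the positions up to `i.succ` splits off the term at position `0`. -/
theorem sum_Iic_fin_succ {n : ℕ} (f : Fin (n + 1) → ℝ) (i : Fin n) :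
    ∑ j ∈ Finset.Iic i.succ, f j = f 0 + ∑ j ∈ Finset.Iic i, f j.succ := by
  have h : Finset.Iic i.succ = insert 0 ((Finset.Iic i).map (Fin.succEmb n)) := by
    ext j
    cases j using Fin.cases <;> simp
  rw [h, Finset.sum_insert (by simp), Finset.sum_map]
  rfl

/-- The probabilities of no success and of a first success at each position add up to `1`. -/
theorem prod_one_sub_add_sum_first_success {n : ℕ} (q : Fin n → ℝ) :
    ∏ i, (1 - q i) + ∑ i, q i * ∏ j ∈ Finset.Iio i, (1 - q j) = 1 := by
  induction n with
  | zero => simp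
  | succ n ih =>
    have h := ih fun i => q i.succ
    have h₀ : Finset.Iio (0 : Fin (n + 1)) = ∅ := by ext j; simp
    simp only [Fin.prod_univ_succ, Fin.sum_univ_succ, prod_Iio_fin_succ, h₀, Finset.prod_empty,
      mul_left_comm _ (1 - q 0), ← Finset.mul_sum]
    linear_combination (1 - q 0) * h

/-- The expected end time is the sum of the response times, each weighted by the probability
that no earlier position succeeds. -/
theorem expected_end_time_eq {n : ℕ} (q t : Fin n → ℝ) :
    (∏ i, (1 - q i)) * ∑ k, t k +
        ∑ i, (q i * ∏ j ∈ Finset.Iio i, (1 - q j)) * ∑ k ∈ Finset.Iic i, t k =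
      ∑ i, t i * ∏ j ∈ Finset.Iio i, (1 - q j) := by
  induction n with
  | zero => simp
  | succ n ih =>
    have h := ih (fun i => q i.succ) fun i => t i.succ
    have h₁ := prod_one_sub_add_sum_first_success fun i : Fin n => q i.succ
    have h₀ : Finset.Iio (0 : Fin (n + 1)) = ∅ := by ext j; simp
    have h₂ : Finset.Iic (0 : Fin (n + 1)) = {0} := by ext j; simp
    simp only [Fin.prod_univ_succ, Fin.sum_univ_succ, prod_Iio_fin_succ, sum_Iic_fin_succ, h₀, h₂,
      Finset.prod_empty, Finset.sum_singleton, mul_left_comm _ (1 - q 0), mul_assoc (1 - q 0),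
      mul_add, Finset.sum_add_distrib, ← Finset.mul_sum, ← Finset.sum_mul]
    linear_combination (1 - q 0) * h + (1 - q 0) * t 0 * h₁

/-- Expected value of the first success when the opportunities of the list `l`, with success
probabilities `p` and values `g`, are tried in order. -/
noncomputable def firstSuccessValue {α : Type*} (g p : α → ℝ) : List α → ℝ
  | [] => 0
  | a :: l => g a * p a + (1 - p a) * firstSuccessValue g p l

theorem firstSuccessValue_ofFn {α : Type*} (g p : α → ℝ) {n : ℕ} (f : Fin n → α) :
    firstSuccessValue g p (List.ofFn f) =
      ∑ i, g (f i) * p (f i) * ∏ j ∈ Finset.Iio i, (1 - p (f j)) := by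
  induction n with
  | zero => simp [firstSuccessValue]
  | succ n ih =>
    have h₀ : Finset.Iio (0 : Fin (n + 1)) = ∅ := by ext j; simp
    simp only [List.ofFn_succ, firstSuccessValue, ih, Fin.sum_univ_succ, prod_Iio_fin_succ, h₀,
      Finset.prod_empty, mul_left_comm _ (1 - p (f 0)), ← Finset.mul_sum, mul_one]

/-- Moving an element to the front of a sorted list does not increase the value. -/
theorem firstSuccessValue_cons_erase_le {α : Type*} [DecidableEq α] {g p : α → ℝ}
    (hp : ∀ a, p a ∈ Set.Icc (0 : ℝ) 1) {a : α} {l : List α}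
    (hl : l.Pairwise fun x y => g y ≤ g x) (ha : a ∈ l) :
    firstSuccessValue g p (a :: l.erase a) ≤ firstSuccessValue g p l := by
  induction l with
  | nil => simp at ha
  | cons b l ih =>
    by_cases hab : b = a
    · simp [hab]
    · have hal : a ∈ l := (List.mem_cons.1 ha).resolve_left (Ne.symm hab)
      rw [List.pairwise_cons] at hl
      have h := mul_le_mul_of_nonneg_left (ih hl.2 hal) (sub_nonneg.2 (hp b).2)
      have hswap := mul_nonneg (mul_nonneg (hp a).1 (hp b).1) (sub_nonneg.2 (hl.1 a hal))
      rw [List.erase_cons_tail (by simpa using hab)]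
      simp only [firstSuccessValue] at h ⊢
      linarith

/-- A list sorted by non-increasing value is optimal among its permutations. -/
theorem firstSuccessValue_le_of_perm {α : Type*} {g p : α → ℝ}
    (hp : ∀ a, p a ∈ Set.Icc (0 : ℝ) 1) {l l' : List α}
    (hl : l.Pairwise fun x y => g y ≤ g x) (h : l'.Perm l) :
    firstSuccessValue g p l' ≤ firstSuccessValue g p l := by
  classical
  induction l' generalizing l with
  | nil => rw [h.nil_eq]
  | cons a l' ih =>
    obtain ⟨ha, hperm⟩ := List.cons_perm_iff_perm_erase.1 h
    refine le_trans ?_ (firstSuccessValue_cons_erase_le hp hl ha)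
    have := mul_le_mul_of_nonneg_left (ih (hl.sublist List.erase_sublist) hperm)
      (sub_nonneg.2 (hp a).2)
    simp only [firstSuccessValue]
    linarith

theorem Jobj_eq_firstSuccessValue {n : ℕ} {r p θ : Fin n → ℝ} (hp : ∀ i, p i ≠ 0) (η : ℝ)
    (σ : Equiv.Perm (Fin n)) :
    Jobj r p θ η σ = firstSuccessValue (fun i => r i - η * θ i / p i) p (List.ofFn σ) := by
  have h := expected_end_time_eq (fun i => p (σ i)) fun i => θ (σ i)
  simp only [Jobj, Rbar, Tbar, cSched, cLastSched]
  rw [h, firstSuccessValue_ofFn, Finset.mul_sum, ← Finset.sum_sub_distrib]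
  refine Finset.sum_congr rfl fun i _ => ?_
  rw [sub_mul, div_mul_cancel₀ _ (hp (σ i))]
  ring

/-- If the sequence `r_{σ(i)} - η θ_{σ(i)} / p_{σ(i)}` is ordered
non-increasingly, then `σ` maximizes `J` over all permutations. -/
theorem sorted_implies_optimal {n : ℕ} (hn : 1 ≤ n) (r p θ : Fin n → ℝ)
    (hp : ∀ i, p i ∈ Set.Ioc (0 : ℝ) 1) (hr : ∀ i, 0 ≤ r i) (hθ : ∀ i, 0 ≤ θ i)
    (η : ℝ) (hη : 0 ≤ η) (σ : Equiv.Perm (Fin n))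
    (hsorted : Antitone fun i : Fin n => r (σ i) - η * θ (σ i) / p (σ i)) :
    ∀ τ : Equiv.Perm (Fin n), Jobj r p θ η τ ≤ Jobj r p θ η σ := by
  intro τ
  have hp' : ∀ i, p i ≠ 0 := fun i => (hp i).1.ne'
  rw [Jobj_eq_firstSuccessValue hp', Jobj_eq_firstSuccessValue hp']
  refine firstSuccessValue_le_of_perm (fun i => ⟨(hp i).1.le, (hp i).2⟩) ?_ ?_
  · exact List.pairwise_ofFn.2 fun i j hij => hsorted hij.le
  · refine (List.perm_ext_iff_of_nodup (List.nodup_ofFn.2 τ.injective)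
      (List.nodup_ofFn.2 σ.injective)).2 fun a => ?_
    simp [List.mem_ofFn', τ.surjective.range_eq, σ.surjective.range_eq]
end

section
/- Let n ≥ 1, let p_i ∈ (0,1] for i = 1,…,n, let r_i ≥ 0, θ_i ≥ 0, and let η ≥ 0. Let σ be a permutation of {1,…,n}, fix 1 ≤ k ≤ n−1, and let σ' be the permutation obtained from σ by exchanging the entries in positions k and k+1. Then the residual values satisfy V_{k−1}(σ) − V_{k−1}(σ') = p_{σ(k)} p_{σ(k+1)} [ (r_{σ(k)} − η θ_{σ(k)}/p_{σ(k)}) − (r_{σ(k+1)} − η θ_{σ(k+1)}/p_{σ(k+1)}) ]. -/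
open Finset

/-- Swapping two positions that both lie in `s` moves only elements of `s`. -/
lemma swap_support_subset {α : Type*} [DecidableEq α] {s : Finset α} {a b : α}
    (ha : a ∈ s) (hb : b ∈ s) : {x | Equiv.swap a b x ≠ x} ⊆ (s : Set α) := by
  intro x hx
  by_contra hxs
  refine hx (Equiv.swap_apply_of_ne_of_ne ?_ ?_) <;> rintro rfl <;> exact hxs ‹_›

/-- Exchanging two positions at or before `i` changes only the reward term of `z_i`. -/
lemma zSeq_mul_swap {n : ℕ} (r θ : Fin n → ℝ) (η : ℝ) (σ : Equiv.Perm (Fin n))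
    {a b i : Fin n} (ha : a ≤ i) (hb : b ≤ i) :
    zSeq r θ η (σ * Equiv.swap a b) i =
      r (σ (Equiv.swap a b i)) - η * ∑ j ∈ Finset.Iic i, θ (σ j) := by
  simp only [zSeq, Equiv.Perm.mul_apply]
  rw [Equiv.Perm.sum_comp (Equiv.swap a b) (Finset.Iic i) (fun j => θ (σ j))
    (swap_support_subset (by simpa using ha) (by simpa using hb))]

/-- The residual value from `k` on, with the terms at `k` and its successor `l` split off. -/
lemma Vres_eq_add_add_sum {n : ℕ} (r p θ : Fin n → ℝ) (η : ℝ) (σ : Equiv.Perm (Fin n))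
    {k l : Fin n} (hl : (l : ℕ) = k + 1) :
    Vres r p θ η σ k =
      zSeq r θ η σ k * p (σ k) + zSeq r θ η σ l * p (σ l) * (1 - p (σ k)) +
        ∑ i ∈ Finset.Ioi l, zSeq r θ η σ i * p (σ i) * ∏ j ∈ Finset.Ico k i, (1 - p (σ j)) := by
  have hIci : Finset.Ici k = insert k (insert l (Finset.Ioi l)) := by
    ext x
    simp only [Finset.mem_Ici, Finset.mem_insert, Finset.mem_Ioi, Fin.le_def, Fin.lt_def,
      Fin.ext_iff]
    omega
  have hIco : Finset.Ico k l = {k} := by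
    ext x
    simp only [Finset.mem_Ico, Finset.mem_singleton, Fin.le_def, Fin.lt_def, Fin.ext_iff]
    omega
  have hk : k ∉ insert l (Finset.Ioi l) := by
    simp only [Finset.mem_insert, Finset.mem_Ioi, Fin.lt_def, Fin.ext_iff]
    omega
  rw [Vres, hIci, Finset.sum_insert hk, Finset.sum_insert (by simp), hIco]
  simp [add_assoc]

/-- The exchange formula for the residual value: swapping the entries in
(0-based) positions `k` and `k+1` of `σ` changes the residual value `V_{k-1}`
(in the paper's 1-based indexing, i.e. `Vres … k` here) by
`p_{σ(k)} p_{σ(k+1)} [(r_{σ(k)} - η θ_{σ(k)}/p_{σ(k)}) -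
(r_{σ(k+1)} - η θ_{σ(k+1)}/p_{σ(k+1)})]`. -/
theorem exchange_formula_V {n : ℕ} (hn : 1 ≤ n) (r p θ : Fin n → ℝ)
    (hp : ∀ i, p i ∈ Set.Ioc (0 : ℝ) 1) (hr : ∀ i, 0 ≤ r i) (hθ : ∀ i, 0 ≤ θ i)
    (η : ℝ) (hη : 0 ≤ η) (σ : Equiv.Perm (Fin n))
    (k : Fin n) (hk : (k : ℕ) + 1 < n) :
    Vres r p θ η σ k - Vres r p θ η (σ * Equiv.swap k ⟨(k : ℕ) + 1, hk⟩) k =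
      p (σ k) * p (σ ⟨(k : ℕ) + 1, hk⟩) *
        ((r (σ k) - η * θ (σ k) / p (σ k)) -
          (r (σ ⟨(k : ℕ) + 1, hk⟩) -
            η * θ (σ ⟨(k : ℕ) + 1, hk⟩) / p (σ ⟨(k : ℕ) + 1, hk⟩))) := by
  set l : Fin n := ⟨(k : ℕ) + 1, hk⟩
  have hl : (l : ℕ) = k + 1 := rfl
  have hkl : k < l := by rw [Fin.lt_def]; omega
  have hpk : p (σ k) ≠ 0 := (hp _).1.ne'
  have hpl : p (σ l) ≠ 0 := (hp _).1.ne'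
  have hIicl : Finset.Iic l = insert l (Finset.Iic k) := by
    ext x
    simp only [Finset.mem_Iic, Finset.mem_insert, Fin.le_def, Fin.ext_iff]
    omega
  have hIick : Finset.Iic k = insert k (Finset.Iio k) := by
    ext x
    simp only [Finset.mem_Iic, Finset.mem_insert, Finset.mem_Iio, le_iff_eq_or_lt]
  have hsuml (f : Fin n → ℝ) : ∑ j ∈ Finset.Iic l, f j = f l + ∑ j ∈ Finset.Iic k, f j := by
    rw [hIicl, Finset.sum_insert (by simpa using hkl)]
  have hsumk (f : Fin n → ℝ) : ∑ j ∈ Finset.Iic k, f j = f k + ∑ j ∈ Finset.Iio k, f j := by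
    rw [hIick, Finset.sum_insert (by simp)]
  have hprefix : ∑ j ∈ Finset.Iio k, θ ((σ * Equiv.swap k l) j) =
      ∑ j ∈ Finset.Iio k, θ (σ j) := by
    refine Finset.sum_congr rfl fun j hj => ?_
    have hj : j < k := Finset.mem_Iio.mp hj
    rw [Equiv.Perm.mul_apply, Equiv.swap_apply_of_ne_of_ne hj.ne (hj.trans hkl).ne]
  have htail : ∑ i ∈ Finset.Ioi l, zSeq r θ η (σ * Equiv.swap k l) i *
        p ((σ * Equiv.swap k l) i) * ∏ j ∈ Finset.Ico k i, (1 - p ((σ * Equiv.swap k l) j)) =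
      ∑ i ∈ Finset.Ioi l, zSeq r θ η σ i * p (σ i) *
        ∏ j ∈ Finset.Ico k i, (1 - p (σ j)) := by
    refine Finset.sum_congr rfl fun i hi => ?_
    have hi : l < i := Finset.mem_Ioi.mp hi
    have hki : k < i := hkl.trans hi
    rw [zSeq_mul_swap r θ η σ hki.le hi.le]
    simp only [Equiv.Perm.mul_apply]
    rw [Equiv.Perm.prod_comp (Equiv.swap k l) (Finset.Ico k i) (fun j => 1 - p (σ j))
      (swap_support_subset (by simpa using hki) (by simpa using ⟨hkl.le, hi⟩)),
      Equiv.swap_apply_of_ne_of_ne hki.ne' hi.ne', zSeq]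
  rw [Vres_eq_add_add_sum r p θ η σ hl, Vres_eq_add_add_sum r p θ η _ hl, htail,
    zSeq_mul_swap r θ η σ hkl.le le_rfl]
  simp only [zSeq, hsuml, hsumk, Equiv.Perm.mul_apply, Equiv.swap_apply_left,
    Equiv.swap_apply_right]
  simp only [Equiv.Perm.mul_apply] at hprefix
  rw [hprefix]
  field_simp
  ring
end

section
/- Let n ≥ 1, let p_i ∈ (0,1] for i = 1,…,n, let r_i ≥ 0, θ_i ≥ 0, and let η ≥ 0. For every permutation σ of {1,…,n}, the objective decomposes as J(σ) = R̄(σ) − η T̄(σ) = −η (∏_{j=1}^{n} (1 − p_j)) (∑_{k=1}^{n} θ_k) + ∑_{i=1}^{n} z_i(σ) p_{σ(i)} ∏_{j=1}^{i-1} (1 − p_{σ(j)}), where z_i(σ) = r_{σ(i)} − η ∑_{k=1}^{i} θ_{σ(k)}. In particular, the first term −η (∏_{j=1}^{n} (1 − p_j)) (∑_{k=1}^{n} θ_k) does not depend on the permutation σ. -/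
open Finset

/-- Decomposition of the objective:
`J(σ) = -η (∏_j (1-p_j)) (∑_k θ_k) + ∑_i z_i(σ) p_{σ(i)} ∏_{j<i} (1-p_{σ(j)})`,
where the first term manifestly does not depend on the permutation `σ`. -/
theorem Jobj_decomposition {n : ℕ} (hn : 1 ≤ n) (r p θ : Fin n → ℝ)
    (hp : ∀ i, p i ∈ Set.Ioc (0 : ℝ) 1) (hr : ∀ i, 0 ≤ r i) (hθ : ∀ i, 0 ≤ θ i)
    (η : ℝ) (hη : 0 ≤ η) (σ : Equiv.Perm (Fin n)) :
    Jobj r p θ η σ =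
      -η * (∏ j, (1 - p j)) * (∑ k, θ k) +
        ∑ i, zSeq r θ η σ i * p (σ i) * ∏ j ∈ Finset.Iio i, (1 - p (σ j)) := by
  have hsum : ∑ i, zSeq r θ η σ i * p (σ i) * ∏ j ∈ Finset.Iio i, (1 - p (σ j)) =
      Rbar r p σ - η * ∑ i, cSched p σ i * ∑ k ∈ Finset.Iic i, θ (σ k) := by
    rw [Rbar, Finset.mul_sum, ← Finset.sum_sub_distrib]
    refine Finset.sum_congr rfl fun i _ => ?_
    rw [zSeq, cSched]
    ring
  have hlast : cLastSched p σ = ∏ j, (1 - p j) := Equiv.prod_comp σ fun j => 1 - p j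
  rw [hsum, Jobj, Tbar, hlast, Equiv.sum_comp σ θ]
  ring
end
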